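/- For every β ∈ Φ and every t ∈ ℤ with ω^t(β) ≠ β, one has (β, ω^t(β)) ≤ 0. -/

import Mathlib

open scoped RealInnerProductSpace

namespace Folding

variable {E : Type*} [NormedAddCommGroup E] [InnerProductSpace ℝ E]

/-- The coroot `α^∨ = 2α/(α,α)` of a nonzero vector `α`. -/
noncomputable def coroot (α : E) : E := (2 / ⟪α, α⟫) • α

/-- The reflection `s_α(x) = x - (α^∨, x) α`. -/
noncomputable def reflVec (α x : E) : E := x - ⟪coroot α, x⟫ • α

/-- `Φ` is a (finite, not necessarily reduced) root system in `E`. -/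
def IsRootSystem (Φ : Set E) : Prop :=
  Φ.Finite ∧ (0 : E) ∉ Φ ∧ Submodule.span ℝ Φ = ⊤ ∧
    (∀ α ∈ Φ, ∀ β ∈ Φ, reflVec α β ∈ Φ) ∧
    ∀ α ∈ Φ, ∀ β ∈ Φ, ∃ n : ℤ, ⟪coroot α, β⟫ = (n : ℝ)

/-- `Φ` is reduced: no root is half of another root. -/
def IsReducedRS (Φ : Set E) : Prop := ∀ α ∈ Φ, (2⁻¹ : ℝ) • α ∉ Φ

/-- `Φ` is irreducible: nonempty and not a disjoint union of two nonempty
mutually orthogonal subsets. -/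
def IsIrreducibleRS (Φ : Set E) : Prop :=
  Φ.Nonempty ∧
    ¬∃ Φ₁ Φ₂ : Set E, Φ₁.Nonempty ∧ Φ₂.Nonempty ∧ Φ₁ ∪ Φ₂ = Φ ∧ Disjoint Φ₁ Φ₂ ∧
      ∀ u ∈ Φ₁, ∀ v ∈ Φ₂, ⟪u, v⟫ = 0

/-- `Δ` is a basis (a set of simple roots) of the root system `Φ`:
it is a vector space basis of `E`, and every root is a linear combination of `Δ`
whose coefficients are all nonnegative integers or all nonpositive integers. -/
def IsBaseRS (Φ : Set E) (Δ : Finset E) : Prop :=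
  ↑Δ ⊆ Φ ∧ LinearIndependent ℝ (fun α : {x : E // x ∈ Δ} => (α : E)) ∧
    Submodule.span ℝ (Δ : Set E) = ⊤ ∧
    ∀ β ∈ Φ, ∃ c : E → ℤ, ((∀ α, 0 ≤ c α) ∨ (∀ α, c α ≤ 0)) ∧
      β = ∑ α ∈ Δ, (c α : ℝ) • α

/-- `ω` belongs to the Weyl group of `Φ`: it is a product of reflections in roots. -/
def InWeylGroup (Φ : Set E) (ω : E ≃ₗᵢ[ℝ] E) : Prop :=
  ∃ l : List E, (∀ α ∈ l, α ∈ Φ) ∧ ∀ x : E, ω x = l.foldr reflVec x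

/-- The average `x^ω = (1/o(ω)) Σ_{t=1}^{o(ω)} ω^t(x)`, where `o(ω)` is the order of `ω`. -/
noncomputable def avg (ω : E ≃ₗᵢ[ℝ] E) (x : E) : E :=
  (orderOf ω : ℝ)⁻¹ • ∑ t ∈ Finset.range (orderOf ω), (ω ^ (t + 1)) x

/-- The fixed-point set `E^ω`. -/
def fixedSet (ω : E ≃ₗᵢ[ℝ] E) : Set E := {x | ω x = x}

/-- The fixed-point subspace `E^ω`. -/
def fixedSubmodule (ω : E ≃ₗᵢ[ℝ] E) : Submodule ℝ E :=
  LinearMap.ker ((ω.toLinearEquiv : E →ₗ[ℝ] E) - LinearMap.id)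

/-- The folded root system `Φ_re^ω = {β^ω : β ∈ Φ, β^ω ≠ 0}`. -/
noncomputable def foldedRoots (Φ : Set E) (ω : E ≃ₗᵢ[ℝ] E) : Set E :=
  {v | v ≠ 0 ∧ ∃ β ∈ Φ, avg ω β = v}

/-- The `⟨ω⟩`-orbit `O(β) = {ω^t(β) : t ∈ ℤ}`. -/
def orbitOf (ω : E ≃ₗᵢ[ℝ] E) (β : E) : Set E := {γ | ∃ t : ℤ, (ω ^ t) β = γ}

/-- `N(β) = {γ ∈ O(β) : γ ≠ ±β, (β,γ) ≠ 0}`. -/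
def nbrOf (ω : E ≃ₗᵢ[ℝ] E) (β : E) : Set E :=
  {γ | γ ∈ orbitOf ω β ∧ γ ≠ β ∧ γ ≠ -β ∧ ⟪β, γ⟫ ≠ 0}


/-- `Δ^ω`: the averages of the simple roots whose `⟨ω⟩`-orbit avoids `α₀ = -htilde`. -/
noncomputable def simpleAvg (Δ : Finset E) (htilde : E) (ω : E ≃ₗᵢ[ℝ] E) : Set E :=
  {v | ∃ α ∈ (Δ : Set E), -htilde ∉ orbitOf ω α ∧ avg ω α = v}

/-- `π̄_S = (Σ_{α ∈ S} ϖ_α^∨)^ω` for a subset `S` of `Δ₀`. -/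
noncomputable def pibar (ω : E ≃ₗᵢ[ℝ] E) (ϖ : E → E) (S : Set E) : E :=
  avg ω (∑ᶠ γ ∈ S, ϖ γ)

end Folding


open Folding

namespace Folding

variable {E : Type*} [NormedAddCommGroup E] [InnerProductSpace ℝ E]

theorem InWeylGroup.apply_mem {Φ : Set E} {ω : E ≃ₗᵢ[ℝ] E} (hΦ : IsRootSystem Φ)
    (hω : InWeylGroup Φ ω) {β : E} (hβ : β ∈ Φ) : ω β ∈ Φ := by
  obtain ⟨l, hl, hωl⟩ := hω
  rw [hωl]
  clear hωl
  induction l with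
  | nil => exact hβ
  | cons a l ih =>
    exact hΦ.2.2.2.1 a (hl a (by simp)) _ (ih fun b hb => hl b (by simp [hb]))

theorem IsRootSystem.neg_mem {Φ : Set E} (hΦ : IsRootSystem Φ) {β : E} (hβ : β ∈ Φ) :
    -β ∈ Φ := by
  have hne : ⟪β, β⟫ ≠ 0 := fun h => hΦ.2.1 (inner_self_eq_zero.mp h ▸ hβ)
  have hrefl : reflVec β β = -β := by
    rw [reflVec, coroot, real_inner_smul_left, div_mul_cancel₀ _ hne, two_smul]
    abel
  exact hrefl ▸ hΦ.2.2.2.1 β hβ β hβ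

/-- Two distinct roots of the same length at an acute angle differ by a root. -/
theorem IsRootSystem.sub_mem_of_norm_eq {Φ : Set E} (hΦ : IsRootSystem Φ) {β γ : E}
    (hβ : β ∈ Φ) (hγ : γ ∈ Φ) (hnorm : ‖γ‖ = ‖β‖) (hne : γ ≠ β) (hpos : 0 < ⟪β, γ⟫) :
    γ - β ∈ Φ := by
  have hβ0 : β ≠ 0 := fun h => hΦ.2.1 (h ▸ hβ)
  have hββ : 0 < ⟪β, β⟫ := real_inner_self_pos.mpr hβ0
  have hlt : ⟪β, γ⟫ < ⟪β, β⟫ := by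
    have h := norm_sub_sq_real γ β
    have h0 : 0 < ‖γ - β‖ := norm_pos_iff.mpr (sub_ne_zero.mpr hne)
    rw [real_inner_self_eq_norm_sq]
    rw [hnorm, real_inner_comm] at h
    nlinarith
  obtain ⟨n, hn⟩ := hΦ.2.2.2.2 β hβ γ hγ
  have hmul : (n : ℝ) * ⟪β, β⟫ = 2 * ⟪β, γ⟫ := by
    rw [← hn, coroot, real_inner_smul_left]
    field_simp
  have hn0 : (0 : ℝ) < n := by
    by_contra! h
    nlinarith
  have hn2 : (n : ℝ) < 2 := by
    by_contra! h
    nlinarith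
  have hn1 : n = 1 := by
    have h0 : 0 < n := by exact_mod_cast hn0
    have h2 : n < 2 := by exact_mod_cast hn2
    omega
  have hrefl : reflVec β γ = γ - β := by
    rw [reflVec, hn, hn1, Int.cast_one, one_smul]
  exact hrefl ▸ hΦ.2.2.2.1 β hβ γ hγ

/-- The height: the linear functional equal to `1` on every simple root. -/
theorem IsBaseRS.exists_height {Φ : Set E} {Δ : Finset E} (hΔ : IsBaseRS Φ Δ) :
    ∃ ht : E →ₗ[ℝ] ℝ, ∀ α ∈ Δ, ht α = 1 := by
  have hspan : ⊤ ≤ Submodule.span ℝ (Set.range fun α : {x : E // x ∈ Δ} => (α : E)) := by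
    rw [Subtype.range_coe_subtype]
    exact hΔ.2.2.1.ge
  let b := Module.Basis.mk hΔ.2.1 hspan
  refine ⟨b.constr ℝ fun _ => (1 : ℝ), fun α hα => ?_⟩
  have h := b.constr_basis ℝ (fun _ => (1 : ℝ)) ⟨α, hα⟩
  rwa [Module.Basis.mk_apply] at h

theorem IsBaseRS.height_ne_zero {Φ : Set E} {Δ : Finset E} (hΦ : IsRootSystem Φ)
    (hΔ : IsBaseRS Φ Δ) {ht : E →ₗ[ℝ] ℝ} (hht : ∀ α ∈ Δ, ht α = 1) {β : E} (hβ : β ∈ Φ) :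
    ht β ≠ 0 := by
  intro h0
  obtain ⟨c, hc, hsum⟩ := hΔ.2.2.2 β hβ
  have hcsum : ∑ α ∈ Δ, c α = 0 := by
    have h : ht β = ∑ α ∈ Δ, (c α : ℝ) := by
      rw [hsum, map_sum]
      exact Finset.sum_congr rfl fun α hα => by simp [hht α hα]
    rw [h0] at h
    exact_mod_cast h.symm
  have hczero : ∀ α ∈ Δ, c α = 0 := by
    rcases hc with hc | hc
    · exact (Finset.sum_eq_zero_iff_of_nonneg fun α _ => hc α).mp hcsum
    · exact (Finset.sum_eq_zero_iff_of_nonpos fun α _ => hc α).mp hcsum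
  refine hΦ.2.1 ?_
  have hβ0 : β = 0 := by
    rw [hsum]
    exact Finset.sum_eq_zero fun α hα => by simp [hczero α hα]
  exact hβ0 ▸ hβ

/-- A linear map that permutes the extended simple roots preserves heights of roots modulo the
height of the highest root plus one. -/
theorem IsBaseRS.exists_height_map_sub_eq {Φ : Set E} {Δ : Finset E} (hΔ : IsBaseRS Φ Δ)
    {ht : E →ₗ[ℝ] ℝ} (hht : ∀ α ∈ Δ, ht α = 1) {θ : E} {ω : E ≃ₗᵢ[ℝ] E}
    (hω : ∀ α ∈ Δ, ω α ∈ (Δ : Set E) ∪ {-θ}) {β : E} (hβ : β ∈ Φ) :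
    ∃ k : ℤ, ht (ω β) - ht β = k * (ht θ + 1) := by
  have hsimple : ∀ α ∈ Δ, ∃ k : ℤ, ht (ω α) - ht α = k * (ht θ + 1) := by
    intro α hα
    rcases hω α hα with h | h
    · exact ⟨0, by rw [hht _ h, hht α hα]; simp⟩
    · refine ⟨-1, ?_⟩
      rw [Set.mem_singleton_iff.mp h, hht α hα, map_neg]
      push_cast
      ring
  choose! k hk using hsimple
  obtain ⟨c, -, hsum⟩ := hΔ.2.2.2 β hβ
  refine ⟨∑ α ∈ Δ, c α * k α, ?_⟩
  rw [hsum]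
  simp only [map_sum, map_smul, smul_eq_mul]
  push_cast
  rw [← Finset.sum_sub_distrib, Finset.sum_mul]
  refine Finset.sum_congr rfl fun α hα => ?_
  rw [← mul_sub, hk α hα, mul_assoc]

end Folding

theorem inner_with_orbit_nonpos
    {E : Type*} [NormedAddCommGroup E] [InnerProductSpace ℝ E] [FiniteDimensional ℝ E]
    (Φ : Set E) (Δ : Finset E) (coeff : E → E → ℝ) (htilde : E) (ω : E ≃ₗᵢ[ℝ] E)
    (hΦrs : IsRootSystem Φ) (hΦred : IsReducedRS Φ) (hΦirr : IsIrreducibleRS Φ)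
    (hΔ : IsBaseRS Φ Δ)
    (hcoeff : ∀ β ∈ Φ, β = ∑ α ∈ Δ, coeff β α • α)
    (hht : htilde ∈ Φ)
    (hhighest : ∀ β ∈ Φ, β ≠ htilde → ∑ α ∈ Δ, coeff β α < ∑ α ∈ Δ, coeff htilde α)
    (hωW : InWeylGroup Φ ω)
    (hωΔ₀ : ⇑ω '' (↑Δ ∪ {-htilde}) = ↑Δ ∪ {-htilde}) :
    ∀ β ∈ Φ, ∀ t : ℤ, (ω ^ t) β ≠ β → ⟪β, (ω ^ t) β⟫ ≤ 0 := by
  obtain ⟨ht, hht1⟩ := hΔ.exists_height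
  have hsum : ∀ β ∈ Φ, ht β = ∑ α ∈ Δ, coeff β α := by
    intro β hβ
    conv_lhs => rw [hcoeff β hβ]
    rw [map_sum]
    exact Finset.sum_congr rfl fun α hα => by simp [hht1 α hα]
  have hle : ∀ β ∈ Φ, ht β ≤ ht htilde := by
    intro β hβ
    by_cases h : β = htilde
    · rw [h]
    · rw [hsum β hβ, hsum htilde hht]
      exact (hhighest β hβ h).le
  have hω : ∀ α ∈ Δ, ω α ∈ (Δ : Set E) ∪ {-htilde} := fun α hα =>
    hωΔ₀ ▸ Set.mem_image_of_mem ω (Or.inl hα)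
  have hpow : ∀ n : ℕ, ∀ β ∈ Φ, (ω ^ n) β ∈ Φ ∧
      ∃ k : ℤ, ht ((ω ^ n) β) - ht β = k * (ht htilde + 1) := by
    intro n β hβ
    induction n with
    | zero => exact ⟨by simpa using hβ, 0, by simp⟩
    | succ n ih =>
      obtain ⟨hmem, k, hk⟩ := ih
      obtain ⟨j, hj⟩ := hΔ.exists_height_map_sub_eq hht1 hω hmem
      rw [pow_succ', LinearIsometryEquiv.coe_mul, Function.comp_apply]
      refine ⟨hωW.apply_mem hΦrs hmem, j + k, ?_⟩
      push_cast
      linarith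
  have hnat : ∀ n : ℕ, ∀ β ∈ Φ, (ω ^ n) β ≠ β → ⟪β, (ω ^ n) β⟫ ≤ 0 := by
    intro n β hβ hne
    by_contra! hpos
    obtain ⟨hmem, k, hk⟩ := hpow n β hβ
    have hγ : (ω ^ n) β - β ∈ Φ :=
      hΦrs.sub_mem_of_norm_eq hβ hmem (LinearIsometryEquiv.norm_map _ _) hne hpos
    have hupper := hle _ hγ
    have hlower := hle _ (hΦrs.neg_mem hγ)
    have hnonneg := hle _ (hΦrs.neg_mem hht)
    rw [map_neg] at hlower hnonneg
    rw [map_sub, hk] at hupper hlower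
    have hk0 : k = 0 := by
      have h1 : (k : ℝ) < 1 := by
        by_contra! h
        nlinarith
      have h2 : (-1 : ℝ) < k := by
        by_contra! h
        nlinarith
      have h1' : k < 1 := by exact_mod_cast h1
      have h2' : -1 < k := by exact_mod_cast h2
      omega
    refine hΔ.height_ne_zero hΦrs hht1 hγ ?_
    rw [map_sub, hk, hk0, Int.cast_zero, zero_mul]
  intro β hβ t hne
  obtain ⟨n, rfl | rfl⟩ := t.eq_nat_or_neg
  · rw [zpow_natCast] at hne ⊢
    exact hnat n β hβ hne
  · rw [zpow_neg, zpow_natCast] at hne ⊢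
    have hcancel : (ω ^ n) ((ω ^ n)⁻¹ β) = β := (ω ^ n).apply_symm_apply β
    rw [← LinearIsometryEquiv.inner_map_map (ω ^ n), hcancel, real_inner_comm]
    refine hnat n β hβ fun h => hne ?_
    exact (ω ^ n).injective (hcancel.trans h.symm)
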